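/- arXiv:1307.1946 — 4 statements merged into one kernel-verified Lean document; each statement's English description precedes it below -/
import Mathlib

section
/- (Giaquinta–Modica estimate.) Let δ ≥ 0 and let a, b ∈ ℝ^{nN}. Then 4^{−(1+2δ)} · (1 + |a|² + |b−a|²)^{δ/2} ≤ ∫₀¹ (1 + |s a + (1−s) b|²)^{δ/2} ds ≤ 4^{δ} · (1 + |a|² + |b−a|²)^{δ/2}. -/
open MeasureTheory

section SegmentEstimates

variable {E : Type*} [NormedAddCommGroup E] [NormedSpace ℝ E]

theorem smul_add_one_sub_smul_eq (a b : E) (s : ℝ) :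
    s • a + (1 - s) • b = a + (1 - s) • (b - a) := by
  module

theorem continuous_one_add_norm_sq_segment_rpow (a b : E) {p : ℝ} (hp : 0 ≤ p) :
    Continuous fun s : ℝ => (1 + ‖s • a + (1 - s) • b‖ ^ 2) ^ p :=
  Continuous.rpow_const (by fun_prop) fun _ => Or.inr hp

theorem one_add_norm_sq_segment_le (a b : E) {s : ℝ} (hs : s ∈ Set.Icc (0 : ℝ) 1) :
    1 + ‖s • a + (1 - s) • b‖ ^ 2 ≤ 16 * (1 + ‖a‖ ^ 2 + ‖b - a‖ ^ 2) := by
  have h : ‖s • a + (1 - s) • b‖ ≤ ‖a‖ + ‖b - a‖ := by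
    rw [smul_add_one_sub_smul_eq]
    refine (norm_add_le _ _).trans ?_
    rw [norm_smul, Real.norm_of_nonneg (sub_nonneg.2 hs.2)]
    nlinarith [norm_nonneg (b - a), hs.1]
  nlinarith [norm_nonneg (s • a + (1 - s) • b), sq_nonneg (‖a‖ - ‖b - a‖), norm_nonneg a,
    norm_nonneg (b - a)]

theorem le_one_add_norm_sq_segment_of_norm_sub_le (a b : E) (hab : ‖b - a‖ ≤ 2 * ‖a‖) {s : ℝ}
    (hs : s ∈ Set.Icc (3 / 4 : ℝ) 1) :
    256⁻¹ * (1 + ‖a‖ ^ 2 + ‖b - a‖ ^ 2) ≤ 1 + ‖s • a + (1 - s) • b‖ ^ 2 := by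
  have h : ‖a‖ / 2 ≤ ‖s • a + (1 - s) • b‖ := by
    rw [smul_add_one_sub_smul_eq]
    have := norm_sub_le_norm_add a ((1 - s) • (b - a))
    rw [norm_smul, Real.norm_of_nonneg (sub_nonneg.2 hs.2)] at this
    nlinarith [norm_nonneg (b - a), hs.1]
  nlinarith [norm_nonneg a, norm_nonneg (b - a)]

theorem le_one_add_norm_sq_segment_of_le_norm_sub (a b : E) (hab : 2 * ‖a‖ ≤ ‖b - a‖) {s : ℝ}
    (hs : s ∈ Set.Icc (0 : ℝ) (1 / 4)) :
    256⁻¹ * (1 + ‖a‖ ^ 2 + ‖b - a‖ ^ 2) ≤ 1 + ‖s • a + (1 - s) • b‖ ^ 2 := by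
  have h : ‖b - a‖ / 4 ≤ ‖s • a + (1 - s) • b‖ := by
    rw [smul_add_one_sub_smul_eq, add_comm]
    have := norm_sub_le_norm_add ((1 - s) • (b - a)) a
    rw [norm_smul, Real.norm_of_nonneg (by linarith [hs.2])] at this
    nlinarith [norm_nonneg (b - a), hs.2]
  nlinarith [norm_nonneg a, norm_nonneg (b - a)]

end SegmentEstimates

theorem mul_le_integral_of_le_on_subinterval {f : ℝ → ℝ} (hf : Continuous f) (h0 : ∀ s, 0 ≤ f s)
    {a b c d m : ℝ} (hac : a ≤ c) (hcd : c ≤ d) (hdb : d ≤ b) (hm : ∀ s ∈ Set.Icc c d, m ≤ f s) :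
    (d - c) * m ≤ ∫ s in a..b, f s :=
  calc (d - c) * m = ∫ _ in c..d, m := by simp
    _ ≤ ∫ s in c..d, f s := intervalIntegral.integral_mono_on hcd
        intervalIntegrable_const (hf.intervalIntegrable _ _) hm
    _ ≤ ∫ s in a..b, f s := intervalIntegral.integral_mono_interval hac hcd hdb
        (Filter.Eventually.of_forall h0) (hf.intervalIntegrable _ _)

theorem four_rpow_eq_sixteen_rpow_half (δ : ℝ) : (4 : ℝ) ^ δ = 16 ^ (δ / 2) := by
  rw [show (16 : ℝ) = 4 ^ (2 : ℝ) by norm_num, ← Real.rpow_mul (by norm_num)]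
  congr 1
  ring

theorem four_rpow_neg_one_add_two_mul (δ : ℝ) :
    (4 : ℝ) ^ (-(1 + 2 * δ)) = 1 / 4 * 256⁻¹ ^ (δ / 2) := by
  rw [show (256⁻¹ : ℝ) = 4 ^ (-4 : ℝ) by rw [Real.rpow_neg (by norm_num)]; norm_num,
    ← Real.rpow_mul (by norm_num),
    show -(1 + 2 * δ) = -1 + -4 * (δ / 2) by ring, Real.rpow_add (by norm_num),
    Real.rpow_neg_one]
  norm_num

/-- **Giaquinta–Modica estimate.** For `δ ≥ 0` and `a, b ∈ ℝ^{nN}`,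
`4^{-(1+2δ)}(1+|a|²+|b-a|²)^{δ/2} ≤ ∫₀¹ (1+|sa+(1-s)b|²)^{δ/2} ds
  ≤ 4^{δ}(1+|a|²+|b-a|²)^{δ/2}`. -/
theorem statement5 (n N : ℕ) (δ : ℝ) (hδ : 0 ≤ δ)
    (a b : EuclideanSpace ℝ (Fin (n * N))) :
    (4:ℝ) ^ (-(1 + 2 * δ)) * (1 + ‖a‖ ^ 2 + ‖b - a‖ ^ 2) ^ (δ / 2)
        ≤ ∫ s in (0:ℝ)..1, (1 + ‖s • a + (1 - s) • b‖ ^ 2) ^ (δ / 2) ∧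
      ∫ s in (0:ℝ)..1, (1 + ‖s • a + (1 - s) • b‖ ^ 2) ^ (δ / 2)
        ≤ (4:ℝ) ^ δ * (1 + ‖a‖ ^ 2 + ‖b - a‖ ^ 2) ^ (δ / 2) := by
  have hp : 0 ≤ δ / 2 := by positivity
  have hX : 0 ≤ 1 + ‖a‖ ^ 2 + ‖b - a‖ ^ 2 := by positivity
  have hcont := continuous_one_add_norm_sq_segment_rpow a b hp
  have hnonneg (s : ℝ) : 0 ≤ (1 + ‖s • a + (1 - s) • b‖ ^ 2) ^ (δ / 2) := by positivity
  constructor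
  · rw [four_rpow_neg_one_add_two_mul, mul_assoc, ← Real.mul_rpow (by norm_num) hX]
    rcases le_total ‖b - a‖ (2 * ‖a‖) with hab | hab
    · rw [show (1 / 4 : ℝ) = 1 - 3 / 4 by norm_num]
      exact mul_le_integral_of_le_on_subinterval hcont hnonneg (by norm_num) (by norm_num) le_rfl
        fun s hs => Real.rpow_le_rpow (by positivity)
          (le_one_add_norm_sq_segment_of_norm_sub_le a b hab hs) hp
    · rw [← sub_zero (1 / 4 : ℝ)]
      exact mul_le_integral_of_le_on_subinterval hcont hnonneg le_rfl (by norm_num) (by norm_num)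
        fun s hs => Real.rpow_le_rpow (by positivity)
          (le_one_add_norm_sq_segment_of_le_norm_sub a b hab hs) hp
  · rw [four_rpow_eq_sixteen_rpow_half, ← Real.mul_rpow (by norm_num) hX]
    calc ∫ s in (0:ℝ)..1, (1 + ‖s • a + (1 - s) • b‖ ^ 2) ^ (δ / 2)
        ≤ ∫ _ in (0:ℝ)..1, (16 * (1 + ‖a‖ ^ 2 + ‖b - a‖ ^ 2)) ^ (δ / 2) :=
          intervalIntegral.integral_mono_on zero_le_one (hcont.intervalIntegrable _ _)
            intervalIntegrable_const fun s hs => Real.rpow_le_rpow (by positivity)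
              (one_add_norm_sq_segment_le a b hs) hp
      _ = _ := by simp
end

section
/- Let α ∈ (0,1) and let η : (0,∞) → (0,∞) be nondecreasing such that t ↦ t^{−α}η(t) is nonincreasing on (0,∞), and assume η(s) ≤ 1 for all s ∈ (0,1]. Then for every σ with 0 < σ ≤ 1/α, every s ∈ [0,1] and every t > 0 one has s · η(t)^σ ≤ s · η(s)^σ + t. In particular s η(t) ≤ s η(s) + t and s √(η(t)) ≤ s √(η(s)) + t for s ∈ [0,1], t > 0. -/
open Set

/-- A positive function for which `t ^ (-α) * η t` is nonincreasing grows at most like `t ^ α`. -/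
lemma le_div_rpow_mul_of_antitoneOn {α : ℝ} {η : ℝ → ℝ}
    (hanti : AntitoneOn (fun t => t ^ (-α) * η t) (Ioi (0:ℝ))) {s t : ℝ} (hs : 0 < s)
    (hst : s ≤ t) : η t ≤ (t / s) ^ α * η s := by
  have ht : 0 < t := hs.trans_le hst
  have h : t ^ (-α) * η t ≤ s ^ (-α) * η s := hanti hs ht hst
  have htα : 0 < t ^ α := Real.rpow_pos_of_pos ht α
  calc η t = t ^ α * (t ^ (-α) * η t) := by
        rw [Real.rpow_neg ht.le, mul_inv_cancel_left₀ htα.ne']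
    _ ≤ t ^ α * (s ^ (-α) * η s) := mul_le_mul_of_nonneg_left h htα.le
    _ = (t / s) ^ α * η s := by
        rw [Real.div_rpow ht.le hs.le, Real.rpow_neg hs.le, div_eq_mul_inv, mul_assoc]

lemma mul_rpow_le_of_antitoneOn {α : ℝ} (hα : 0 < α) {η : ℝ → ℝ}
    (hpos : ∀ t ∈ Ioi (0:ℝ), 0 < η t) (hmono : MonotoneOn η (Ioi (0:ℝ)))
    (hanti : AntitoneOn (fun t => t ^ (-α) * η t) (Ioi (0:ℝ)))
    {σ : ℝ} (hσ : 0 < σ) (hσα : σ ≤ 1 / α) {s t : ℝ} (hs : 0 < s) (hηs : η s ≤ 1)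
    (ht : 0 < t) : s * η t ^ σ ≤ s * η s ^ σ + t := by
  have hηs0 : 0 < η s := hpos s hs
  have hηt0 : 0 < η t := hpos t ht
  rcases le_total t s with hts | hst
  · have h : η t ^ σ ≤ η s ^ σ := Real.rpow_le_rpow hηt0.le (hmono ht hs hts) hσ.le
    linarith [mul_le_mul_of_nonneg_left h hs.le]
  · have hr : 1 ≤ t / s := (one_le_div hs).2 hst
    have hr0 : 0 ≤ t / s := zero_le_one.trans hr
    have hασ : α * σ ≤ 1 := by
      rw [mul_comm]
      exact (le_div_iff₀ hα).1 hσα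
    have h : η t ^ σ ≤ t / s :=
      calc η t ^ σ ≤ ((t / s) ^ α) ^ σ := by
            refine Real.rpow_le_rpow hηt0.le ?_ hσ.le
            exact (le_div_rpow_mul_of_antitoneOn hanti hs hst).trans
              (mul_le_of_le_one_right (Real.rpow_nonneg hr0 α) hηs)
        _ = (t / s) ^ (α * σ) := (Real.rpow_mul hr0 α σ).symm
        _ ≤ (t / s) ^ (1 : ℝ) := Real.rpow_le_rpow_of_exponent_le hr hασ
        _ = t / s := Real.rpow_one _
    have h' : s * η t ^ σ ≤ t := by
      rw [mul_comm]
      exact (le_div_iff₀ hs).1 h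
    linarith [mul_nonneg hs.le (Real.rpow_nonneg hηs0.le σ)]

/-- Let `α ∈ (0,1)` and `η : (0,∞) → (0,∞)` be nondecreasing with
`t ↦ t^{-α} η t` nonincreasing on `(0,∞)` and `η ≤ 1` on `(0,1]`. Then for
`0 < σ ≤ 1/α`, `s ∈ [0,1]` and `t > 0` one has `s η(t)^σ ≤ s η(s)^σ + t`;
in particular `s η(t) ≤ s η(s) + t` and `s √(η t) ≤ s √(η s) + t`. -/
theorem statement6 (α : ℝ) (hα : α ∈ Ioo (0:ℝ) 1) (η : ℝ → ℝ)
    (hpos : ∀ t ∈ Ioi (0:ℝ), 0 < η t)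
    (hmono : MonotoneOn η (Ioi (0:ℝ)))
    (hanti : AntitoneOn (fun t => t ^ (-α) * η t) (Ioi (0:ℝ)))
    (hle1 : ∀ s ∈ Ioc (0:ℝ) 1, η s ≤ 1) :
    (∀ σ : ℝ, 0 < σ → σ ≤ 1 / α → ∀ s ∈ Icc (0:ℝ) 1, ∀ t ∈ Ioi (0:ℝ),
        s * η t ^ σ ≤ s * η s ^ σ + t) ∧
      (∀ s ∈ Icc (0:ℝ) 1, ∀ t ∈ Ioi (0:ℝ), s * η t ≤ s * η s + t) ∧
      (∀ s ∈ Icc (0:ℝ) 1, ∀ t ∈ Ioi (0:ℝ),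
        s * Real.sqrt (η t) ≤ s * Real.sqrt (η s) + t) := by
  obtain ⟨hα0, hα1⟩ := hα
  have main : ∀ σ : ℝ, 0 < σ → σ ≤ 1 / α → ∀ s ∈ Icc (0:ℝ) 1, ∀ t ∈ Ioi (0:ℝ),
      s * η t ^ σ ≤ s * η s ^ σ + t := by
    rintro σ hσ hσα s ⟨hs0, hs1⟩ t ht
    rcases hs0.eq_or_lt with rfl | hs
    · simpa using (mem_Ioi.mp ht).le
    · exact mul_rpow_le_of_antitoneOn hα0 hpos hmono hanti hσ hσα hs (hle1 s ⟨hs, hs1⟩) ht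
  have hα_inv : 1 ≤ 1 / α := (one_le_div hα0).2 hα1.le
  refine ⟨main, fun s hs t ht => ?_, fun s hs t ht => ?_⟩
  · simpa using main 1 one_pos hα_inv s hs t ht
  · simpa only [Real.sqrt_eq_rpow] using
      main (1 / 2) (by norm_num) (le_trans (by norm_num) hα_inv) s hs t ht
end

section
/- Let α ∈ (0,1) and let η : (0,∞) → (0,∞) be nondecreasing such that t ↦ t^{−α}η(t) is nonincreasing on (0,∞), and assume η(s) ≤ 1 for all s ∈ (0,1]. Let β ∈ (0,1] and θ ∈ (0,1/8] and assume ∫₀^1 η(τ)^{β/2} τ^{−1} dτ < ∞. Define F̃(t) := ( ∫₀^t η(τ)^{β/2} τ^{−1} dτ )². Then η(t) ≤ (α²β² / (4 (1 − θ^{αβ})²)) · F̃(t) for all t ∈ (0,1]. -/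
open Set MeasureTheory

/-- If `t ↦ t ^ (-α) * η t` is nonincreasing, then the Dini-type integral of `η ^ b` dominates
`η ^ b` itself. -/
theorem rpow_le_mul_integral_rpow_div {α b t : ℝ} {η : ℝ → ℝ} (hα : 0 < α) (hb : 0 < b)
    (ht : 0 < t) (hpos : ∀ s ∈ Ioi (0 : ℝ), 0 < η s)
    (hanti : AntitoneOn (fun s => s ^ (-α) * η s) (Ioi (0 : ℝ)))
    (hint : IntegrableOn (fun τ => η τ ^ b / τ) (Ioo 0 t)) :
    η t ^ b ≤ α * b * ∫ τ in Ioo (0 : ℝ) t, η τ ^ b / τ := by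
  have hp : 0 < α * b := mul_pos hα hb
  have hη := hpos t ht
  have hp1 : -1 < α * b - 1 := by linarith
  have hle : ∀ τ ∈ Ioo (0 : ℝ) t,
      η t ^ b * t ^ (-(α * b)) * τ ^ (α * b - 1) ≤ η τ ^ b / τ := by
    rintro τ ⟨hτ, hτt⟩
    have h : t ^ (-α) * η t ≤ τ ^ (-α) * η τ := hanti hτ ht hτt.le
    have h' := Real.rpow_le_rpow (by positivity) h hb.le
    rw [Real.mul_rpow (by positivity) hη.le, Real.mul_rpow (by positivity) (hpos τ hτ).le,
      ← Real.rpow_mul ht.le, ← Real.rpow_mul hτ.le, neg_mul, Real.rpow_neg hτ.le,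
      inv_mul_eq_div, le_div_iff₀ (by positivity)] at h'
    rw [Real.rpow_sub_one hτ.ne', mul_div_assoc', div_le_div_iff_of_pos_right hτ]
    linarith
  have hval : ∫ τ in Ioo (0 : ℝ) t, τ ^ (α * b - 1) = t ^ (α * b) / (α * b) := by
    rw [← integral_Ioc_eq_integral_Ioo, ← intervalIntegral.integral_of_le ht.le,
      integral_rpow (Or.inl hp1), sub_add_cancel, Real.zero_rpow hp.ne', sub_zero]
  have hpow : IntegrableOn (fun τ : ℝ => τ ^ (α * b - 1)) (Ioo 0 t) :=
    (intervalIntegral.integrableOn_Ioo_rpow_iff ht).2 hp1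
  have key := setIntegral_mono_on (hpow.const_mul (η t ^ b * t ^ (-(α * b)))) hint
    measurableSet_Ioo hle
  rw [integral_const_mul, hval, Real.rpow_neg ht.le] at key
  have htp : 0 < t ^ (α * b) := Real.rpow_pos_of_pos ht _
  calc η t ^ b = α * b * (η t ^ b * (t ^ (α * b))⁻¹ * (t ^ (α * b) / (α * b))) := by field_simp
    _ ≤ _ := by gcongr

/-- Let `α ∈ (0,1)` and `η : (0,∞) → (0,∞)` be nondecreasing with
`t ↦ t^{-α} η t` nonincreasing on `(0,∞)` and `η ≤ 1` on `(0,1]`. Let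
`β ∈ (0,1]`, `θ ∈ (0,1/8]`, and assume `∫₀¹ η(τ)^{β/2} τ⁻¹ dτ < ∞`. With
`F̃(t) := (∫₀^t η(τ)^{β/2} τ⁻¹ dτ)²` one has
`η(t) ≤ (α²β²/(4(1-θ^{αβ})²)) F̃(t)` for all `t ∈ (0,1]`. -/
theorem statement9 (α : ℝ) (hα : α ∈ Ioo (0:ℝ) 1) (η : ℝ → ℝ)
    (hpos : ∀ t ∈ Ioi (0:ℝ), 0 < η t)
    (hmono : MonotoneOn η (Ioi (0:ℝ)))
    (hanti : AntitoneOn (fun t => t ^ (-α) * η t) (Ioi (0:ℝ)))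
    (hle1 : ∀ s ∈ Ioc (0:ℝ) 1, η s ≤ 1)
    (β : ℝ) (hβ : β ∈ Ioc (0:ℝ) 1) (θ : ℝ) (hθ : θ ∈ Ioc (0:ℝ) (1/8))
    (hint : IntegrableOn (fun τ => η τ ^ (β / 2) / τ) (Ioo 0 1)) :
    ∀ t ∈ Ioc (0:ℝ) 1,
      η t ≤ α ^ 2 * β ^ 2 / (4 * (1 - θ ^ (α * β)) ^ 2)
              * (∫ τ in Ioo (0:ℝ) t, η τ ^ (β / 2) / τ) ^ 2 := by
  rintro t ⟨ht, ht1⟩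
  obtain ⟨hα, -⟩ := hα
  obtain ⟨hβ, hβ1⟩ := hβ
  obtain ⟨hθ, hθ1⟩ := hθ
  have hη := hpos t ht
  have key := rpow_le_mul_integral_rpow_div hα (half_pos hβ) ht hpos hanti
    (hint.mono_set (Ioo_subset_Ioo_right ht1))
  set I := ∫ τ in Ioo (0 : ℝ) t, η τ ^ (β / 2) / τ
  have hθpos : 0 < θ ^ (α * β) := Real.rpow_pos_of_pos hθ _
  have hθlt : θ ^ (α * β) < 1 := Real.rpow_lt_one hθ.le (by linarith) (mul_pos hα hβ)
  have hden : (1 - θ ^ (α * β)) ^ 2 ≤ 1 := pow_le_one₀ (by linarith) (by linarith)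
  have hden0 : 0 < (1 - θ ^ (α * β)) ^ 2 := pow_pos (by linarith) 2
  calc η t = η t ^ (1 : ℝ) := (Real.rpow_one _).symm
    _ ≤ η t ^ β := Real.rpow_le_rpow_of_exponent_ge hη (hle1 t ⟨ht, ht1⟩) hβ1
    _ = (η t ^ (β / 2)) ^ 2 := by
      rw [← Real.rpow_natCast, ← Real.rpow_mul hη.le]
      norm_num
    _ ≤ (α * (β / 2) * I) ^ 2 := by gcongr
    _ = α ^ 2 * β ^ 2 / (4 * 1) * I ^ 2 := by ring
    _ ≤ _ := by gcongr
end

section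
/- Let α ∈ (0,1) and let η : (0,∞) → (0,∞) be nondecreasing such that t ↦ t^{−α}η(t) is nonincreasing on (0,∞), and assume η(s) ≤ 1 for all s ∈ (0,1]. Let β ∈ (0,1] and assume ∫₀^1 η(τ)^{β/2} τ^{−1} dτ < ∞, and define F̃(t) := ( ∫₀^t η(τ)^{β/2} τ^{−1} dτ )². Then for every θ ∈ (0,1/8] and every t ∈ (0,1], t^{−α} F̃(t) ≤ 4 (θ t)^{−α} F̃(θ t). -/
open Set MeasureTheory

/-- If `t ↦ t ^ (-α) * η t` is nonincreasing on `(0, ∞)`, then `η` satisfies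
`η τ ≤ θ ^ (-α) * η (θ * τ)` for `θ ∈ (0, 1]`. -/
theorem le_rpow_neg_mul_of_antitoneOn {α : ℝ} {η : ℝ → ℝ}
    (hanti : AntitoneOn (fun t => t ^ (-α) * η t) (Ioi (0 : ℝ)))
    {θ τ : ℝ} (hθ : 0 < θ) (hθ1 : θ ≤ 1) (hτ : 0 < τ) :
    η τ ≤ θ ^ (-α) * η (θ * τ) := by
  have h : τ ^ (-α) * η τ ≤ (θ * τ) ^ (-α) * η (θ * τ) :=
    hanti (mul_pos hθ hτ) hτ (mul_le_of_le_one_left hτ.le hθ1)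
  rw [Real.mul_rpow hθ.le hτ.le, mul_right_comm, mul_comm] at h
  exact le_of_mul_le_mul_right h (Real.rpow_pos_of_pos hτ _)

/-- Scaling estimate for `∫₀ᵗ η(τ)ᵖ τ⁻¹ dτ` when `t ↦ t ^ (-α) * η t` is nonincreasing. -/
theorem integral_rpow_div_le_rpow_mul_integral {α p θ t : ℝ} {η : ℝ → ℝ} (hp : 0 ≤ p)
    (hη : ∀ t ∈ Ioi (0 : ℝ), 0 ≤ η t)
    (hanti : AntitoneOn (fun t => t ^ (-α) * η t) (Ioi (0 : ℝ)))
    (hθ : 0 < θ) (hθ1 : θ ≤ 1) (ht : 0 ≤ t)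
    (hint : IntegrableOn (fun τ => η τ ^ p / τ) (Ioo 0 t)) :
    ∫ τ in Ioo 0 t, η τ ^ p / τ ≤
      θ ^ (-α * p) * ∫ τ in Ioo 0 (θ * t), η τ ^ p / τ := by
  have hθt : θ * t ≤ t := mul_le_of_le_one_left ht hθ1
  have hθt0 : 0 ≤ θ * t := mul_nonneg hθ.le ht
  have hI : IntervalIntegrable (fun τ => η τ ^ p / τ) volume 0 t :=
    (intervalIntegrable_iff_integrableOn_Ioo_of_le ht).2 hint
  have hIθ : IntervalIntegrable (fun τ => η τ ^ p / τ) volume 0 (θ * t) :=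
    (intervalIntegrable_iff_integrableOn_Ioo_of_le hθt0).2
      (hint.mono_set (Ioo_subset_Ioo_right hθt))
  have hIcomp : IntervalIntegrable (fun τ => η (θ * τ) ^ p / (θ * τ)) volume 0 t := by
    simpa [hθ.ne'] using hIθ.comp_mul_left (c := θ)
  have key : ∫ τ in (0 : ℝ)..t, η τ ^ p / τ ≤
      ∫ τ in (0 : ℝ)..t, θ ^ (-α * p) * θ * (η (θ * τ) ^ p / (θ * τ)) := by
    refine intervalIntegral.integral_mono_on_of_le_Ioo ht hI (hIcomp.const_mul _) ?_
    intro τ hτ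
    have hτ0 : 0 < τ := hτ.1
    calc η τ ^ p / τ ≤ (θ ^ (-α) * η (θ * τ)) ^ p / τ := by
          gcongr
          · exact hη τ hτ0
          · exact le_rpow_neg_mul_of_antitoneOn hanti hθ hθ1 hτ0
      _ = θ ^ (-α * p) * θ * (η (θ * τ) ^ p / (θ * τ)) := by
          rw [Real.mul_rpow (Real.rpow_nonneg hθ.le _) (hη _ (mul_pos hθ hτ0)),
            ← Real.rpow_mul hθ.le]
          field_simp
  rw [intervalIntegral.integral_const_mul,
    intervalIntegral.integral_comp_mul_left (fun τ => η τ ^ p / τ) hθ.ne', mul_zero,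
    smul_eq_mul, mul_assoc, mul_inv_cancel_left₀ hθ.ne'] at key
  rwa [intervalIntegral.integral_of_le ht, intervalIntegral.integral_of_le hθt0,
    integral_Ioc_eq_integral_Ioo, integral_Ioc_eq_integral_Ioo] at key

/-- Let `α ∈ (0,1)` and `η : (0,∞) → (0,∞)` be nondecreasing with
`t ↦ t^{-α} η t` nonincreasing on `(0,∞)` and `η ≤ 1` on `(0,1]`. Let
`β ∈ (0,1]`, assume `∫₀¹ η(τ)^{β/2} τ⁻¹ dτ < ∞`, and set
`F̃(t) := (∫₀^t η(τ)^{β/2} τ⁻¹ dτ)²`. Then for every `θ ∈ (0,1/8]` and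
`t ∈ (0,1]`, `t^{-α} F̃(t) ≤ 4 (θt)^{-α} F̃(θt)`. -/
theorem statement10 (α : ℝ) (hα : α ∈ Ioo (0:ℝ) 1) (η : ℝ → ℝ)
    (hpos : ∀ t ∈ Ioi (0:ℝ), 0 < η t)
    (hmono : MonotoneOn η (Ioi (0:ℝ)))
    (hanti : AntitoneOn (fun t => t ^ (-α) * η t) (Ioi (0:ℝ)))
    (hle1 : ∀ s ∈ Ioc (0:ℝ) 1, η s ≤ 1)
    (β : ℝ) (hβ : β ∈ Ioc (0:ℝ) 1)
    (hint : IntegrableOn (fun τ => η τ ^ (β / 2) / τ) (Ioo 0 1)) :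
    ∀ θ ∈ Ioc (0:ℝ) (1/8), ∀ t ∈ Ioc (0:ℝ) 1,
      t ^ (-α) * (∫ τ in Ioo (0:ℝ) t, η τ ^ (β / 2) / τ) ^ 2
        ≤ 4 * (θ * t) ^ (-α)
            * (∫ τ in Ioo (0:ℝ) (θ * t), η τ ^ (β / 2) / τ) ^ 2 := by
  rintro θ ⟨hθ, hθ8⟩ t ⟨ht, ht1⟩
  have hθ1 : θ ≤ 1 := by linarith
  have h := integral_rpow_div_le_rpow_mul_integral (half_pos hβ.1).le
    (fun s hs => (hpos s hs).le) hanti hθ hθ1 ht.le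
    (hint.mono_set (Ioo_subset_Ioo_right ht1))
  have hnonneg : 0 ≤ ∫ τ in Ioo (0 : ℝ) t, η τ ^ (β / 2) / τ :=
    setIntegral_nonneg measurableSet_Ioo fun τ hτ =>
      div_nonneg (Real.rpow_nonneg (hpos τ hτ.1).le _) hτ.1.le
  have hc : (θ ^ (-α * (β / 2))) ^ 2 ≤ θ ^ (-α) := by
    rw [← Real.rpow_natCast, ← Real.rpow_mul hθ.le]
    refine Real.rpow_le_rpow_of_exponent_ge hθ hθ1 ?_
    push_cast
    nlinarith [hα.1, hβ.2]
  rw [Real.mul_rpow hθ.le ht.le]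
  set G := ∫ τ in Ioo (0 : ℝ) (θ * t), η τ ^ (β / 2) / τ
  calc t ^ (-α) * (∫ τ in Ioo (0 : ℝ) t, η τ ^ (β / 2) / τ) ^ 2
      ≤ t ^ (-α) * (θ ^ (-α * (β / 2)) * G) ^ 2 := by gcongr
    _ = (θ ^ (-α * (β / 2))) ^ 2 * (t ^ (-α) * G ^ 2) := by ring
    _ ≤ θ ^ (-α) * (t ^ (-α) * G ^ 2) := by gcongr
    _ ≤ 4 * (θ ^ (-α) * (t ^ (-α) * G ^ 2)) :=
        le_mul_of_one_le_left (by positivity) (by norm_num)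
    _ = 4 * (θ ^ (-α) * t ^ (-α)) * G ^ 2 := by ring
end
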